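/- Let H be a finite-dimensional Hopf algebra over a field k with char k > (dim H)^2. Then the following are equivalent: (i) H is semisimple and cosemisimple; (ii) S_H^2 = id_H; (iii) tr(S_H^2) ≠ 0. -/

import Mathlib

open TensorProduct

/-- A subspace `V` of a coalgebra `H` is a subcoalgebra if `Δ(V) ⊆ V ⊗ V` inside `H ⊗ H`. -/
def IsSubcoalgebra (k : Type*) {H : Type*} [CommRing k] [AddCommGroup H] [Module k H]
    [Coalgebra k H] (V : Submodule k H) : Prop :=
  ∀ x ∈ V, Coalgebra.comul (R := k) x ∈
    LinearMap.range (TensorProduct.map V.subtype V.subtype)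

/-- A coalgebra is cosemisimple if it is the sum of its simple subcoalgebras. -/
def IsCosemisimple (k H : Type*) [CommRing k] [AddCommGroup H] [Module k H]
    [Coalgebra k H] : Prop :=
  sSup {V : Submodule k H | IsSubcoalgebra k V ∧ V ≠ ⊥ ∧
    ∀ W ≤ V, IsSubcoalgebra k W → W = ⊥ ∨ W = V} = ⊤

namespace FiniteDimensionalHopf

open Coalgebra HopfAlgebra WithConv

section Hopf

variable {k H : Type*} [Field k] [Ring H] [HopfAlgebra k H]

/-- Contraction of the second tensor factor: `a ⊗ b ↦ f b • a`. -/
noncomputable def contractRight : (H →ₗ[k] k) →ₗ[k] H ⊗[k] H →ₗ[k] H where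
  toFun f := (TensorProduct.rid k H).toLinearMap ∘ₗ f.lTensor H
  map_add' f g := by ext; simp
  map_smul' c f := by ext; simp

/-- Contraction of the first tensor factor: `a ⊗ b ↦ f a • b`. -/
noncomputable def contractLeft : (H →ₗ[k] k) →ₗ[k] H ⊗[k] H →ₗ[k] H where
  toFun f := (TensorProduct.lid k H).toLinearMap ∘ₗ f.rTensor H
  map_add' f g := by ext; simp
  map_smul' c f := by ext; simp

@[simp]
lemma contractRight_tmul (f : H →ₗ[k] k) (a b : H) : contractRight f (a ⊗ₜ[k] b) = f b • a := by
  simp [contractRight]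

@[simp]
lemma contractLeft_tmul (f : H →ₗ[k] k) (a b : H) : contractLeft f (a ⊗ₜ[k] b) = f a • b := by
  simp [contractLeft]

lemma contractRight_left_mul (f : H →ₗ[k] k) (a : H) (t : H ⊗[k] H) :
    contractRight f ((a ⊗ₜ 1) * t) = a * contractRight f t := by
  induction t with
  | zero => simp
  | tmul b c => simp
  | add s t hs ht => simp [mul_add, hs, ht]

lemma contractRight_mul_left (f : H →ₗ[k] k) (a : H) (t : H ⊗[k] H) :
    contractRight f (t * (a ⊗ₜ 1)) = contractRight f t * a := by
  induction t with
  | zero => simp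
  | tmul b c => simp
  | add s t hs ht => simp [add_mul, hs, ht]

lemma contractLeft_right_mul (f : H →ₗ[k] k) (a : H) (t : H ⊗[k] H) :
    contractLeft f ((1 ⊗ₜ a) * t) = a * contractLeft f t := by
  induction t with
  | zero => simp
  | tmul b c => simp
  | add s t hs ht => simp [mul_add, hs, ht]

lemma contractLeft_mul_right (f : H →ₗ[k] k) (a : H) (t : H ⊗[k] H) :
    contractLeft f (t * (1 ⊗ₜ a)) = contractLeft f t * a := by
  induction t with
  | zero => simp
  | tmul b c => simp
  | add s t hs ht => simp [add_mul, hs, ht]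

lemma apply_contractRight (f g : H →ₗ[k] k) (t : H ⊗[k] H) :
    f (contractRight g t) = g (contractLeft f t) := by
  induction t with
  | zero => simp
  | tmul b c => simp [mul_comm]
  | add s t hs ht => simp [hs, ht]

/-- The left coregular action of the dual: `x ↦ ∑ f(x₂) x₁`. -/
noncomputable def rightHit : (H →ₗ[k] k) →ₗ[k] Module.End k H where
  toFun f := contractRight f ∘ₗ comul
  map_add' f g := by ext; simp
  map_smul' c f := by ext; simp

/-- The right coregular action of the dual: `x ↦ ∑ f(x₁) x₂`. -/
noncomputable def leftHit : (H →ₗ[k] k) →ₗ[k] Module.End k H where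
  toFun f := contractLeft f ∘ₗ comul
  map_add' f g := by ext; simp
  map_smul' c f := by ext; simp

lemma rightHit_apply (f : H →ₗ[k] k) (x : H) : rightHit f x = contractRight f (comul x) := rfl

lemma leftHit_apply (f : H →ₗ[k] k) (x : H) : leftHit f x = contractLeft f (comul x) := rfl

lemma rightHit_repr (f : H →ₗ[k] k) {x : H} {ι : Type*} (ρ : Repr k x ι) :
    rightHit f x = ∑ i ∈ ρ.index, f (ρ.right i) • ρ.left i := by
  simp [rightHit_apply, ← ρ.eq]

lemma leftHit_repr (f : H →ₗ[k] k) {x : H} {ι : Type*} (ρ : Repr k x ι) :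
    leftHit f x = ∑ i ∈ ρ.index, f (ρ.left i) • ρ.right i := by
  simp [leftHit_apply, ← ρ.eq]

lemma apply_rightHit (f g : H →ₗ[k] k) (x : H) : f (rightHit g x) = g (leftHit f x) :=
  apply_contractRight f g _

@[simp]
lemma rightHit_counit : rightHit (counit : H →ₗ[k] k) = LinearMap.id := by
  ext x
  simp [rightHit_apply, contractRight]

@[simp]
lemma leftHit_counit : leftHit (counit : H →ₗ[k] k) = LinearMap.id := by
  ext x
  simp [leftHit_apply, contractLeft]

lemma comul_rightHit (f : H →ₗ[k] k) (x : H) :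
    comul (R := k) (rightHit f x) = (rightHit f).lTensor H (comul x) := by
  have key (u : H ⊗[k] H) (b : H) : (contractRight f).lTensor H
      (TensorProduct.assoc k H H H (u ⊗ₜ b)) = f b • u := by
    induction u with
    | zero => simp
    | tmul c d => simp
    | add u v hu hv => simp [TensorProduct.add_tmul, hu, hv]
  have h := congr((contractRight f).lTensor H $(coassoc_apply (R := k) x))
  rw [← (ℛ k x).eq] at h
  rw [rightHit_repr f (ℛ k x), ← (ℛ k x).eq]
  simpa [key, rightHit_apply] using h

lemma comul_leftHit (f : H →ₗ[k] k) (x : H) :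
    comul (R := k) (leftHit f x) = (leftHit f).rTensor H (comul x) := by
  have key (u : H ⊗[k] H) (b : H) : (contractLeft f).rTensor H
      ((TensorProduct.assoc k H H H).symm (b ⊗ₜ u)) = f b • u := by
    induction u with
    | zero => simp
    | tmul c d => simp [TensorProduct.smul_tmul']
    | add u v hu hv => simp [TensorProduct.tmul_add, hu, hv]
  have h := congr((contractLeft f).rTensor H $(coassoc_symm_apply (R := k) x))
  rw [← (ℛ k x).eq] at h
  rw [leftHit_repr f (ℛ k x), ← (ℛ k x).eq]
  simpa [key, leftHit_apply] using h

lemma rightHit_comp (f g : H →ₗ[k] k) :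
    rightHit f ∘ₗ rightHit g = rightHit (f ∘ₗ rightHit g) := by
  ext x
  simp only [LinearMap.comp_apply, rightHit_apply f, comul_rightHit]
  simp [← (ℛ k x).eq, rightHit_repr (f ∘ₗ rightHit g) (ℛ k x)]

lemma leftHit_comp (f g : H →ₗ[k] k) :
    leftHit f ∘ₗ leftHit g = leftHit (f ∘ₗ leftHit g) := by
  ext x
  simp only [LinearMap.comp_apply, leftHit_apply f, comul_leftHit]
  simp [← (ℛ k x).eq, leftHit_repr (f ∘ₗ leftHit g) (ℛ k x)]

lemma sum_of_conv_eq {E : Type*} [Ring E] [Algebra k E] {A B C : H →ₗ[k] E}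
    (h : toConv A * toConv B = toConv C) {x : H} {ι : Type*} (ρ : Repr k x ι) :
    ∑ i ∈ ρ.index, A (ρ.left i) * B (ρ.right i) = C x := by
  have := congr($h x)
  rw [ρ.convMul_apply] at this
  simpa using this

variable (k H) in
/-- The inclusion `a ↦ a ⊗ 1`. -/
noncomputable abbrev inl : H →ₗ[k] H ⊗[k] H :=
  (Algebra.TensorProduct.includeLeft : H →ₐ[k] H ⊗[k] H).toLinearMap

variable (k H) in
/-- The inclusion `a ↦ 1 ⊗ a`. -/
noncomputable abbrev inr : H →ₗ[k] H ⊗[k] H :=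
  (Algebra.TensorProduct.includeRight : H →ₐ[k] H ⊗[k] H).toLinearMap

lemma conv_comul : toConv (comul : H →ₗ[k] H ⊗[k] H) = toConv (inl k H) * toConv (inr k H) := by
  ext x
  rw [(ℛ k x).convMul_apply]
  simp [(ℛ k x).eq]

lemma conv_algHom_antipode {E : Type*} [Ring E] [Algebra k E] (φ : H →ₐ[k] E) :
    toConv φ.toLinearMap * toConv (φ.toLinearMap ∘ₗ antipode k (A := H)) = 1 := by
  ext x
  rw [(ℛ k x).convMul_apply]
  simp [← map_mul, ← map_sum, sum_mul_antipode_eq_algebraMap_counit (ℛ k x)]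

lemma conv_antipode_algHom {E : Type*} [Ring E] [Algebra k E] (φ : H →ₐ[k] E) :
    toConv (φ.toLinearMap ∘ₗ antipode k (A := H)) * toConv φ.toLinearMap = 1 := by
  ext x
  rw [(ℛ k x).convMul_apply]
  simp [← map_mul, ← map_sum, sum_antipode_mul_eq_algebraMap_counit (ℛ k x)]

lemma conv_comul_antipode :
    toConv (comul ∘ₗ antipode k (A := H) : H →ₗ[k] H ⊗[k] H) =
        toConv (inr k H ∘ₗ antipode k (A := H)) * toConv (inl k H ∘ₗ antipode k (A := H)) := by
  refine (left_inv_eq_right_inv (a := toConv (comul : H →ₗ[k] H ⊗[k] H)) ?_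
    LinearMap.comul_right_inv).symm
  rw [conv_comul, mul_assoc, ← mul_assoc (toConv (inl k H ∘ₗ antipode k (A := H))),
    conv_antipode_algHom, one_mul,
    conv_antipode_algHom]

lemma comul_antipode (x : H) : comul (R := k) (antipode k x) =
    TensorProduct.map (antipode k) (antipode k) (TensorProduct.comm k H H (comul x)) := by
  have := congr($(conv_comul_antipode (k := k) (H := H)) x)
  rw [(ℛ k x).convMul_apply] at this
  simpa [← (ℛ k x).eq] using this

/-- `∑ Δ(x₁)(1 ⊗ S(x₂)) = x ⊗ 1`. -/
lemma sum_comul_mul_antipode {x : H} {ι : Type*} (ρ : Repr k x ι) :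
    ∑ i ∈ ρ.index, comul (R := k) (ρ.left i) * (1 ⊗ₜ antipode k (ρ.right i)) = x ⊗ₜ[k] 1 := by
  refine sum_of_conv_eq (A := comul) (B := inr k H ∘ₗ antipode k (A := H)) (C := inl k H) ?_ ρ
  rw [conv_comul, mul_assoc, conv_algHom_antipode, mul_one]

/-- `∑ (S(x₁) ⊗ 1)Δ(x₂) = 1 ⊗ x`. -/
lemma sum_antipode_mul_comul {x : H} {ι : Type*} (ρ : Repr k x ι) :
    ∑ i ∈ ρ.index, (antipode k (ρ.left i) ⊗ₜ 1) * comul (R := k) (ρ.right i) = 1 ⊗ₜ[k] x := by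
  refine sum_of_conv_eq (A := inl k H ∘ₗ antipode k (A := H)) (B := comul) (C := inr k H) ?_ ρ
  rw [conv_comul, ← mul_assoc, conv_antipode_algHom, one_mul]

/-- `∑ (1 ⊗ x₁)Δ(S(x₂)) = S(x) ⊗ 1`. -/
lemma sum_mul_comul_antipode {x : H} {ι : Type*} (ρ : Repr k x ι) :
    ∑ i ∈ ρ.index, (1 ⊗ₜ ρ.left i) * comul (R := k) (antipode k (ρ.right i)) = antipode k x ⊗ₜ[k]
        1 := by
  refine sum_of_conv_eq (A := inr k H) (B := comul ∘ₗ antipode k (A := H))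
    (C := inl k H ∘ₗ antipode k (A := H)) ?_ ρ
  rw [conv_comul_antipode, ← mul_assoc, conv_algHom_antipode, one_mul]

/-- `∑ Δ(S(x₁))(x₂ ⊗ 1) = 1 ⊗ S(x)`. -/
lemma sum_comul_antipode_mul {x : H} {ι : Type*} (ρ : Repr k x ι) :
    ∑ i ∈ ρ.index, comul (R := k) (antipode k (ρ.left i)) * (ρ.right i ⊗ₜ 1) = 1 ⊗ₜ[k]
        antipode k x := by
  refine sum_of_conv_eq (A := comul ∘ₗ antipode k (A := H)) (B := inl k H)
    (C := inr k H ∘ₗ antipode k (A := H)) ?_ ρ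
  rw [conv_comul_antipode, mul_assoc, conv_antipode_algHom, mul_one]

/-- `∑ (x₁ ⊗ 1)(S ⊗ id)(Δ(x₂)) = 1 ⊗ x`. -/
lemma sum_mul_antipode_rTensor_comul {x : H} {ι : Type*} (ρ : Repr k x ι) :
    ∑ i ∈ ρ.index, (ρ.left i ⊗ₜ 1) * (antipode k (A := H)).rTensor H (comul (R := k) (ρ.right i)) =
      1 ⊗ₜ[k] x := by
  refine sum_of_conv_eq (A := inl k H) (B := (antipode k (A := H)).rTensor H ∘ₗ comul)
    (C := inr k H) ?_ ρ
  have : toConv ((antipode k (A := H)).rTensor H ∘ₗ comul) = toConv (inl k H ∘ₗ antipode k (A := H))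
      * toConv (inr k H) := by
    ext y
    rw [(ℛ k y).convMul_apply]
    simp [← (ℛ k y).eq]
  rw [this, ← mul_assoc, conv_algHom_antipode, one_mul]

lemma tensor_ext {t u : H ⊗[k] H}
    (h : ∀ f g : H →ₗ[k] k, f (contractRight g t) = f (contractRight g u)) : t = u := by
  let b := Module.Free.chooseBasis k H
  refine (b.tensorProduct b).ext_elem fun ⟨i, j⟩ ↦ ?_
  have key : (b.tensorProduct b).coord (i, j) = b.coord i ∘ₗ contractRight (b.coord j) :=
    TensorProduct.ext' fun x y ↦ by simp [mul_comm]
  simpa only [← LinearMap.comp_apply, ← key, Module.Basis.coord_apply]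
    using h (b.coord i) (b.coord j)

/-- The functional `a ⊗ b ↦ f a * g b`. -/
noncomputable def tmulDual (f g : H →ₗ[k] k) : H ⊗[k] H →ₗ[k] k :=
  LinearMap.mul' k k ∘ₗ TensorProduct.map f g

@[simp]
lemma tmulDual_tmul (f g : H →ₗ[k] k) (a b : H) : tmulDual f g (a ⊗ₜ[k] b) = f a * g b := rfl

section FiniteDimensional

variable [FiniteDimensional k H]

lemma exists_sum_mul (β : H ⊗[k] H →ₗ[k] k) : ∃ (n : ℕ) (p q : Fin n → (H →ₗ[k] k)),
    β = ∑ i, tmulDual (p i) (q i) := by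
  let b := Module.finBasis k H
  refine ⟨_, b.coord, fun i ↦ β ∘ₗ TensorProduct.mk k H H (b i), TensorProduct.ext' fun x y ↦ ?_⟩
  have h := congr(β ($(b.sum_repr x) ⊗ₜ y))
  simp only [TensorProduct.sum_tmul, ← TensorProduct.smul_tmul', map_sum, map_smul] at h
  simp [LinearMap.sum_apply, ← h]

@[elab_as_elim]
lemma dual_induction {P : (H ⊗[k] H →ₗ[k] k) → Prop} (β : H ⊗[k] H →ₗ[k] k)
    (tmul : ∀ f g, P (tmulDual f g)) (add : ∀ β γ, P β → P γ → P (β + γ)) : P β := by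
  obtain ⟨n, p, q, rfl⟩ := exists_sum_mul β
  refine Finset.sum_induction _ P add ?_ fun i _ ↦ tmul _ _
  have : tmulDual (k := k) (H := H) 0 0 = 0 := TensorProduct.ext' fun x y ↦ by simp
  exact this ▸ tmul 0 0

/-- The sum `∑ ρ(fᵢ) ∘ F ∘ ρ(gᵢ)` attached to a functional `∑ fᵢ ⊗ gᵢ` on `H ⊗ H`. -/
noncomputable def sandwich (ρ : (H →ₗ[k] k) →ₗ[k] Module.End k H) (F : Module.End k H) :
    (H ⊗[k] H →ₗ[k] k) →ₗ[k] Module.End k H where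
  toFun β := ∑ i, ρ ((Module.finBasis k H).coord i) ∘ₗ F ∘ₗ
    ρ (β ∘ₗ TensorProduct.mk k H H (Module.finBasis k H i))
  map_add' β γ := by
    simp [LinearMap.add_comp, LinearMap.comp_add, Finset.sum_add_distrib]
  map_smul' c β := by
    simp [LinearMap.smul_comp, LinearMap.comp_smul, Finset.smul_sum]

lemma sandwich_tmulDual (ρ : (H →ₗ[k] k) →ₗ[k] Module.End k H) (F : Module.End k H)
    (f g : H →ₗ[k] k) : sandwich ρ F (tmulDual f g) = ρ f ∘ₗ F ∘ₗ ρ g := by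
  let b := Module.finBasis k H
  have h1 (i) : tmulDual f g ∘ₗ TensorProduct.mk k H H (b i) = f (b i) • g := by
    ext; simp
  have h2 : f = ∑ i, f (b i) • b.coord i := (b.sum_dual_apply_smul_coord f).symm
  change ∑ i, ρ (b.coord i) ∘ₗ F ∘ₗ ρ (tmulDual f g ∘ₗ TensorProduct.mk k H H (b i)) = _
  ext x
  have h3 := congr(ρ $h2 (F (ρ g x)))
  simp only [map_sum, map_smul, LinearMap.sum_apply, LinearMap.smul_apply] at h3
  simp [h1, ← h3]

lemma trace_sandwich_rightHit (F : Module.End k H) (β : H ⊗[k] H →ₗ[k] k) :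
    LinearMap.trace k H (sandwich rightHit F β) =
      LinearMap.trace k H (F ∘ₗ
        rightHit (β ∘ₗ (TensorProduct.comm k H H).toLinearMap ∘ₗ comul)) := by
  induction β using dual_induction with
  | tmul f g =>
    rw [sandwich_tmulDual, LinearMap.trace_comp_comm', LinearMap.comp_assoc, rightHit_comp]
    congr 3
    ext x
    simp [rightHit_repr _ (ℛ k x), ← (ℛ k x).eq]
  | add β γ hβ hγ => simp [LinearMap.add_comp, LinearMap.comp_add, hβ, hγ]

lemma trace_sandwich_leftHit (F : Module.End k H) (β : H ⊗[k] H →ₗ[k] k) :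
    LinearMap.trace k H (sandwich leftHit F β) =
      LinearMap.trace k H (F ∘ₗ leftHit (β ∘ₗ comul)) := by
  induction β using dual_induction with
  | tmul f g =>
    rw [sandwich_tmulDual, LinearMap.trace_comp_comm', LinearMap.comp_assoc, leftHit_comp]
    congr 3
    ext x
    simp [leftHit_repr _ (ℛ k x), ← (ℛ k x).eq]
  | add β γ hβ hγ => simp [LinearMap.add_comp, LinearMap.comp_add, hβ, hγ]

lemma sandwich_rightHit_apply (F : Module.End k H) (β : H ⊗[k] H →ₗ[k] k) {x : H}
    {ι : Type*} (r : Repr k x ι) : sandwich rightHit F β x =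
      ∑ i ∈ r.index, rightHit (β ∘ₗ (TensorProduct.mk k H H).flip (r.right i)) (F (r.left i)) := by
  induction β using dual_induction with
  | tmul f g =>
    have h (y) : tmulDual f g ∘ₗ (TensorProduct.mk k H H).flip y = g y • f := by
      ext; simp [mul_comm]
    simp [sandwich_tmulDual, h, rightHit_repr g r]
  | add β γ hβ hγ => simp [LinearMap.add_comp, hβ, hγ, Finset.sum_add_distrib]

lemma sandwich_leftHit_apply (F : Module.End k H) (β : H ⊗[k] H →ₗ[k] k) {x : H}
    {ι : Type*} (r : Repr k x ι) : sandwich leftHit F β x =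
      ∑ i ∈ r.index, leftHit (β ∘ₗ (TensorProduct.mk k H H).flip (r.left i)) (F (r.right i)) := by
  induction β using dual_induction with
  | tmul f g =>
    have h (y) : tmulDual f g ∘ₗ (TensorProduct.mk k H H).flip y = g y • f := by
      ext; simp [mul_comm]
    simp [sandwich_tmulDual, h, leftHit_repr g r]
  | add β γ hβ hγ => simp [LinearMap.add_comp, hβ, hγ, Finset.sum_add_distrib]

/-- The representation of `Δ(S(x))` induced by one of `Δ(x)`. -/
noncomputable def antipodeRepr {x : H} {ι : Type*} (ρ : Repr k x ι) : Repr k (antipode k x) ι where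
  index := ρ.index
  left i := antipode k (ρ.right i)
  right i := antipode k (ρ.left i)
  eq := by rw [comul_antipode, ← ρ.eq]; simp

omit [FiniteDimensional k H] in
lemma contractRight_comp_mulLeft (f : H →ₗ[k] k) (a : H) (t : H ⊗[k] H) :
    contractRight (f ∘ₗ LinearMap.mulLeft k a) t = contractRight f ((1 ⊗ₜ a) * t) := by
  induction t with
  | zero => simp
  | tmul b c => simp
  | add s t hs ht => simp [mul_add, hs, ht]

omit [FiniteDimensional k H] in
lemma contractLeft_comp_mulRight (f : H →ₗ[k] k) (a : H) (t : H ⊗[k] H) :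
    contractLeft (f ∘ₗ LinearMap.mulRight k a) t = contractLeft f (t * (a ⊗ₜ 1)) := by
  induction t with
  | zero => simp
  | tmul b c => simp
  | add s t hs ht => simp [add_mul, hs, ht]

omit [FiniteDimensional k H] in
lemma contractRight_comp_mulRight (f : H →ₗ[k] k) (a : H) (t : H ⊗[k] H) :
    contractRight (f ∘ₗ LinearMap.mulRight k a) t = contractRight f (t * (1 ⊗ₜ a)) := by
  induction t with
  | zero => simp
  | tmul b c => simp
  | add s t hs ht => simp [add_mul, hs, ht]

omit [FiniteDimensional k H] in
lemma eq_of_forall_dual {a b : H} (h : ∀ f : H →ₗ[k] k, f a = f b) : a = b :=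
  sub_eq_zero.1 ((Module.forall_dual_apply_eq_zero_iff k _).1 fun f ↦ by
    rw [map_sub, h, sub_self])

/-- The functional `a ↦ tr(x ↦ S²(x) a)`. -/
noncomputable def traceMulRight : H →ₗ[k] k where
  toFun a := LinearMap.trace k H (LinearMap.mulRight k a ∘ₗ antipode k (A := H) ∘ₗ
      antipode k (A := H))
  map_add' a b := by
    rw [← map_add, ← LinearMap.add_comp]; congr 2; ext; simp [mul_add]
  map_smul' c a := by
    rw [RingHom.id_apply, ← map_smul, ← LinearMap.smul_comp]; congr 2; ext; simp

/-- The functional `a ↦ tr(x ↦ a S²(x))`. -/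
noncomputable def traceMulLeft : H →ₗ[k] k where
  toFun a := LinearMap.trace k H (LinearMap.mulLeft k a ∘ₗ antipode k (A := H) ∘ₗ
      antipode k (A := H))
  map_add' a b := by
    rw [← map_add, ← LinearMap.add_comp]; congr 2; ext; simp [add_mul]
  map_smul' c a := by
    rw [RingHom.id_apply, ← map_smul, ← LinearMap.smul_comp]; congr 2; ext; simp

lemma leftHit_traceMulRight (a : H) :
    leftHit (traceMulRight (k := k)) a = traceMulRight (k := k) a • (1 : H) := by
  refine eq_of_forall_dual fun (f : H →ₗ[k] k) ↦ ?_
  rw [← apply_rightHit]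
  let β : H ⊗[k] H →ₗ[k] k :=
    f ∘ₗ LinearMap.mul' k H ∘ₗ (antipode k (A := H)).rTensor H ∘ₗ
        (TensorProduct.comm k H H).toLinearMap
  have h1 : sandwich rightHit (LinearMap.mulRight k a ∘ₗ antipode k (A := H) ∘ₗ antipode k (A := H))
      β =
      LinearMap.mulRight k (rightHit f a) ∘ₗ antipode k (A := H) ∘ₗ antipode k (A := H) := by
    ext x
    have hβ (v) : β ∘ₗ (TensorProduct.mk k H H).flip v = f ∘ₗ LinearMap.mulLeft k (antipode k v) :=
        by
      ext; simp [β]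
    rw [sandwich_rightHit_apply _ _ (ℛ k x)]
    simp only [hβ, rightHit_apply, contractRight_comp_mulLeft]
    simp only [LinearMap.comp_apply, LinearMap.mulRight_apply, Bialgebra.comul_mul, ← mul_assoc,
      ← map_sum, ← Finset.sum_mul, ← contractRight_left_mul]
    rw [← sum_mul_comul_antipode (antipodeRepr (ℛ k x))]
    rfl
  have h2 : β ∘ₗ (TensorProduct.comm k H H).toLinearMap ∘ₗ comul = f 1 • counit := by
    ext x
    have := congr(f $(sum_antipode_mul_eq_smul (ℛ k x)))
    simp only [map_smul, map_sum] at this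
    simp [β, ← (ℛ k x).eq, this, mul_comm]
  have h3 := trace_sandwich_rightHit (LinearMap.mulRight k a ∘ₗ antipode k (A := H) ∘ₗ
      antipode k (A := H)) β
  rw [h1, h2] at h3
  simpa [traceMulRight, LinearMap.comp_smul, mul_comm] using h3

lemma rightHit_traceMulLeft (a : H) :
    rightHit (traceMulLeft (k := k)) a = traceMulLeft (k := k) a • (1 : H) := by
  refine eq_of_forall_dual fun (f : H →ₗ[k] k) ↦ ?_
  rw [apply_rightHit]
  let β : H ⊗[k] H →ₗ[k] k := f ∘ₗ LinearMap.mul' k H ∘ₗ (antipode k (A := H)).lTensor H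
  have h1 : sandwich leftHit (LinearMap.mulLeft k a ∘ₗ antipode k (A := H) ∘ₗ antipode k (A := H))
      β =
      LinearMap.mulLeft k (leftHit f a) ∘ₗ antipode k (A := H) ∘ₗ antipode k (A := H) := by
    ext x
    have hβ (v) : β ∘ₗ (TensorProduct.mk k H H).flip v = f ∘ₗ LinearMap.mulRight k (antipode k v) :=
        by
      ext; simp [β]
    rw [sandwich_leftHit_apply _ _ (ℛ k x)]
    simp only [hβ, leftHit_apply, contractLeft_comp_mulRight]
    simp only [LinearMap.comp_apply, LinearMap.mulLeft_apply, Bialgebra.comul_mul, mul_assoc,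
      ← map_sum, ← Finset.mul_sum, ← contractLeft_mul_right]
    rw [← sum_comul_antipode_mul (antipodeRepr (ℛ k x))]
    rfl
  have h2 : β ∘ₗ comul = f 1 • counit := by
    ext x
    have := congr(f $(sum_mul_antipode_eq_smul (ℛ k x)))
    simp only [map_smul, map_sum] at this
    simp [β, ← (ℛ k x).eq, this, mul_comm]
  have h3 := trace_sandwich_leftHit (LinearMap.mulLeft k a ∘ₗ antipode k (A := H) ∘ₗ
      antipode k (A := H)) β
  rw [h1, h2] at h3
  simpa [traceMulLeft, LinearMap.comp_smul, mul_comm] using h3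

omit [FiniteDimensional k H] in
lemma sum_mul_antipode_rTensor_mul_comul (t : H ⊗[k] H) {x : H} {ι : Type*} (ρ : Repr k x ι) :
    ∑ i ∈ ρ.index, (ρ.left i ⊗ₜ 1) * (antipode k (A := H)).rTensor H (t * comul (R := k)
        (ρ.right i)) =
      (antipode k (A := H)).rTensor H (t * (1 ⊗ₜ x)) := by
  induction t with
  | zero => simp
  | tmul a b =>
    have h (u : H ⊗[k] H) : (antipode k (A := H)).rTensor H ((a ⊗ₜ b) * u) =
        (1 ⊗ₜ b) * ((antipode k (A := H)).rTensor H u * (antipode k a ⊗ₜ 1)) := by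
      induction u with
      | zero => simp
      | tmul c d => simp [antipode_mul_antidistrib]
      | add u v hu hv => simp [mul_add, add_mul, hu, hv]
    have hcomm (c : H) : (c ⊗ₜ[k] (1 : H)) * ((1 : H) ⊗ₜ b) = (1 ⊗ₜ b) * (c ⊗ₜ 1) := by simp
    simp only [h, ← mul_assoc, hcomm]
    simp only [← Finset.sum_mul, mul_assoc ((1 : H) ⊗ₜ[k] b), ← Finset.mul_sum]
    rw [sum_mul_antipode_rTensor_comul ρ]
    simp
  | add s t hs ht => simp [add_mul, mul_add, Finset.sum_add_distrib, hs, ht]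

omit [FiniteDimensional k H] in
/-- **Maschke's theorem** for Hopf algebras. -/
theorem isSemisimpleRing_of_integral (Λ : H)
    (hΛ : ∀ h, Λ * h = counit (R := k) h • Λ) (h0 : counit (R := k) Λ ≠ 0) :
    IsSemisimpleRing H := by
  have key (h : H) : (h ⊗ₜ 1) * (antipode k (A := H)).rTensor H (comul (R := k) Λ) =
      (antipode k (A := H)).rTensor H (comul Λ * (1 ⊗ₜ h)) := by
    rw [← sum_mul_antipode_rTensor_mul_comul _ (ℛ k h)]
    simp only [← Bialgebra.comul_mul, hΛ, map_smul]
    simp only [mul_smul_comm, ← smul_mul_assoc, ← Finset.sum_mul]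
    congr 1
    have := congr(($(rightHit_counit (k := k) (H := H)) h) ⊗ₜ[k] (1 : H))
    rw [rightHit_repr _ (ℛ k h), TensorProduct.sum_tmul] at this
    simpa [TensorProduct.smul_tmul'] using this.symm
  refine (isSemisimpleModule_iff _ _).2 ⟨fun N ↦ ?_⟩
  obtain ⟨f, hf⟩ := LinearMap.exists_leftInverse_of_injective (N.restrictScalars k).subtype
    (Submodule.ker_subtype _)
  let F : H →ₗ[k] H := (N.restrictScalars k).subtype ∘ₗ f
  have hFN (x) : F x ∈ N := (f x).2
  have hF (x) (hx : x ∈ N) : F x = x :=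
    congrArg Subtype.val (LinearMap.congr_fun hf (⟨x, hx⟩ : N.restrictScalars k))
  let θ (m : H) : H ⊗[k] H →ₗ[k] H :=
    LinearMap.mul' k H ∘ₗ (F ∘ₗ LinearMap.mulRight k m).lTensor H
  have hθl (m a : H) (t : H ⊗[k] H) : θ m ((a ⊗ₜ 1) * t) = a * θ m t := by
    induction t with
    | zero => simp
    | tmul b c => simp [θ, mul_assoc]
    | add s t hs ht => simp only [mul_add, map_add, hs, ht]
  have hθr (m a : H) (t : H ⊗[k] H) :
      θ m ((antipode k (A := H)).rTensor H (t * (1 ⊗ₜ a))) = θ (a * m)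
          ((antipode k (A := H)).rTensor H t) := by
    induction t with
    | zero => simp
    | tmul b c => simp [θ, mul_assoc]
    | add s t hs ht => simp only [add_mul, map_add, hs, ht]
  have hθN (m : H) (t : H ⊗[k] H) : θ m t ∈ N := by
    induction t with
    | zero => simp
    | tmul b c => simpa [θ] using N.smul_mem b (hFN _)
    | add s t hs ht => simpa using add_mem hs ht
  let P : H →ₗ[H] N :=
    { toFun m := ⟨(counit (R := k) Λ)⁻¹ • θ m ((antipode k (A := H)).rTensor H (comul Λ)),
        (N.restrictScalars k).smul_mem _ (hθN _ _)⟩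
      map_add' x y := by
        ext
        have : θ (x + y) = θ x + θ y := TensorProduct.ext' fun a b ↦ by simp [θ, mul_add]
        simp [this]
      map_smul' a x := by
        ext
        simp only [smul_eq_mul, RingHom.id_apply, Submodule.coe_smul, ← hθr, ← key, hθl,
          mul_smul_comm] }
  refine ⟨_, LinearMap.isCompl_of_proj (f := P) fun x ↦ ?_⟩
  ext
  have h1 : θ (x : H) ((antipode k (A := H)).rTensor H (comul Λ)) = counit (R := k) Λ • (x : H) :=
      by
    have h2 := congr($(sum_antipode_mul_eq_smul (ℛ k Λ)) * (x : H))
    rw [← (ℛ k Λ).eq]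
    simp only [Finset.sum_mul, smul_mul_assoc, one_mul] at h2
    rw [← h2]
    simp only [map_sum]
    refine Finset.sum_congr rfl fun i _ ↦ ?_
    have := hF _ (N.smul_mem ((ℛ k Λ).right i) x.2)
    rw [smul_eq_mul] at this
    simp [θ, this, mul_assoc]
  simp [P, h1, h0]

/-- The element `Λ` with `p(Λ) = tr(x ↦ S²(x₁) p(x₂))`. -/
theorem exists_integral_of_trace : ∃ Λ : H, (∀ h, Λ * h = counit (R := k) h • Λ) ∧
    counit (R := k) Λ = LinearMap.trace k H (antipode k (A := H) ∘ₗ antipode k (A := H)) := by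
  let φ : Module.Dual k (H →ₗ[k] k) :=
    LinearMap.trace k H ∘ₗ LinearMap.mulLeft k (antipode k (A := H) ∘ₗ antipode k (A := H) :
        Module.End k H) ∘ₗ rightHit
  obtain ⟨Λ, hΛ⟩ := (Module.evalEquiv k H).surjective φ
  have hp (p : H →ₗ[k] k) : p Λ = LinearMap.trace k H ((antipode k (A := H) ∘ₗ antipode k (A := H))
      ∘ₗ rightHit p) := congr($hΛ p)
  refine ⟨Λ, fun h ↦ eq_of_forall_dual fun (p : H →ₗ[k] k) ↦ ?_, ?_⟩
  · have h1 : (antipode k (A := H) ∘ₗ antipode k (A := H)) ∘ₗ rightHit (p ∘ₗ LinearMap.mulRight k h)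
        = ∑ i ∈ (ℛ k h).index,
        LinearMap.mulRight k (antipode k ((ℛ k h).left i)) ∘ₗ
            ((antipode k (A := H) ∘ₗ antipode k (A := H)) ∘ₗ rightHit p) ∘ₗ
          LinearMap.mulRight k ((ℛ k h).right i) := by
      ext x
      have hc (t : H ⊗[k] H) : antipode k (contractRight p t) =
          contractRight p ((antipode k (A := H)).rTensor H t) := by
        induction t with
        | zero => simp
        | tmul b c => simp
        | add s t hs ht => simp [hs, ht]
      simp only [LinearMap.comp_apply, rightHit_apply, contractRight_comp_mulRight,
        LinearMap.sum_apply, LinearMap.mulRight_apply, Bialgebra.comul_mul]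
      simp only [← antipode_mul_antidistrib, ← map_sum]
      rw [hc, ← sum_mul_antipode_rTensor_mul_comul _ (ℛ k h)]
      simp only [hc, map_sum, contractRight_left_mul]
    have h2 : ∑ i ∈ (ℛ k h).index, LinearMap.mulRight k ((ℛ k h).right i) ∘ₗ
        LinearMap.mulRight k (antipode k ((ℛ k h).left i)) = counit (R := k) h • LinearMap.id := by
      ext x
      simp [mul_assoc, ← Finset.mul_sum, sum_antipode_mul_eq_smul]
    have h3 := hp (p ∘ₗ LinearMap.mulRight k h)
    rw [h1, map_sum] at h3
    simp only [LinearMap.trace_comp_comm' _ (LinearMap.mulRight k (antipode k (A := H) _)),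
      LinearMap.comp_assoc]
      at h3
    rw [← map_sum] at h3
    have h4 : ∑ i ∈ (ℛ k h).index, antipode k (A := H) ∘ₗ antipode k (A := H) ∘ₗ rightHit p ∘ₗ
        LinearMap.mulRight k ((ℛ k h).right i) ∘ₗ
        LinearMap.mulRight k (antipode k ((ℛ k h).left i)) =
        counit (R := k) h • ((antipode k (A := H) ∘ₗ antipode k (A := H)) ∘ₗ rightHit p) := by
      ext x
      have := congr((antipode k (A := H)) ((antipode k (A := H)) (rightHit p ($h2 x))))
      simpa using this
    rw [h4, map_smul, ← hp] at h3
    simpa using h3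
  · rw [hp]; simp

/-- A functional which is a normalized two-sided integral of the dual algebra. -/
structure IsDualIntegral (l : H →ₗ[k] k) : Prop where
  leftHit_eq : ∀ a, leftHit l a = l a • (1 : H)
  rightHit_eq : ∀ a, rightHit l a = l a • (1 : H)
  map_one : l 1 = 1

theorem exists_isDualIntegral_of_trace (ht : LinearMap.trace k H (antipode k (A := H) ∘ₗ
    antipode k (A := H)) ≠ 0) :
    ∃ l : H →ₗ[k] k, IsDualIntegral l := by
  set t := LinearMap.trace k H (antipode k (A := H) ∘ₗ antipode k (A := H)) with htdef
  let l : H →ₗ[k] k := t⁻¹ • traceMulRight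
  let m : H →ₗ[k] k := t⁻¹ • traceMulLeft
  have hl (a : H) : leftHit l a = l a • (1 : H) := by
    simp [l, leftHit_traceMulRight, smul_smul]
  have hm (a : H) : rightHit m a = m a • (1 : H) := by
    simp [m, rightHit_traceMulLeft, smul_smul]
  have hl1 : l 1 = 1 := by
    have : traceMulRight (k := k) (1 : H) = t := by
      simp only [traceMulRight, LinearMap.coe_mk, AddHom.coe_mk, LinearMap.mulRight_one,
        LinearMap.id_comp, htdef]
    simp [l, this, ht]
  have hm1 : m 1 = 1 := by
    have : traceMulLeft (k := k) (1 : H) = t := by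
      simp only [traceMulLeft, LinearMap.coe_mk, AddHom.coe_mk, LinearMap.mulLeft_one,
        LinearMap.id_comp, htdef]
    simp [m, this, ht]
  have hlm : l = m := by
    ext x
    have := apply_rightHit l m x
    simpa [hl, hm, hl1, hm1] using this.symm
  exact ⟨l, hl, fun a ↦ by rw [hlm]; exact hm a, hl1⟩

omit [FiniteDimensional k H] in
theorem isSubcoalgebra_iff {V : Submodule k H} : IsSubcoalgebra k V ↔
    ∀ f : H →ₗ[k] k, ∀ x ∈ V, rightHit f x ∈ V ∧ leftHit f x ∈ V := by
  refine ⟨fun hV f x hx ↦ ?_, fun hV x hx ↦ ?_⟩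
  · obtain ⟨t, ht⟩ := hV x hx
    rw [rightHit_apply, leftHit_apply, ← ht]
    clear ht
    induction t with
    | zero => simp
    | tmul a b => simpa using ⟨V.smul_mem _ a.2, V.smul_mem _ b.2⟩
    | add s t hs ht => simpa using ⟨add_mem hs.1 ht.1, add_mem hs.2 ht.2⟩
  · obtain ⟨π, hπ⟩ := LinearMap.exists_leftInverse_of_injective V.subtype V.ker_subtype
    have hP (v) (hv : v ∈ V) : (π v : H) = v :=
      congrArg Subtype.val (LinearMap.congr_fun hπ ⟨v, hv⟩)
    refine ⟨TensorProduct.map π π (comul x), ?_⟩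
    rw [← LinearMap.comp_apply, ← TensorProduct.map_comp]
    refine tensor_ext fun f g ↦ ?_
    set P : H →ₗ[k] H := V.subtype ∘ₗ π
    have key (t : H ⊗[k] H) : f (contractRight g (TensorProduct.map P P t)) =
        f (P (contractRight (g ∘ₗ P) t)) := by
      induction t with
      | zero => simp
      | tmul a b => simp
      | add s t hs ht => simp [hs, ht]
    rw [key, ← rightHit_apply, ← rightHit_apply]
    have h1 : P (rightHit (g ∘ₗ P) x) = rightHit (g ∘ₗ P) x := hP _ (hV _ _ hx).1
    have h2 : P (leftHit f x) = leftHit f x := hP _ (hV _ _ hx).2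
    rw [h1, apply_rightHit, apply_rightHit, LinearMap.comp_apply, h2]

omit [FiniteDimensional k H] in
lemma rightHit_leftHit_comm (f g : H →ₗ[k] k) :
    rightHit f ∘ₗ leftHit g = leftHit g ∘ₗ rightHit f := by
  ext x
  simp only [LinearMap.comp_apply, rightHit_apply f, comul_leftHit]
  simp [← (ℛ k x).eq]

lemma rightHit_comp_sandwich (F : Module.End k H) (s : H →ₗ[k] k) (β : H ⊗[k] H →ₗ[k] k) :
    rightHit s ∘ₗ sandwich rightHit F β =
      sandwich rightHit F (β ∘ₗ (leftHit s).rTensor H) := by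
  induction β using dual_induction with
  | tmul f g =>
    have : tmulDual f g ∘ₗ (leftHit s).rTensor H = tmulDual (s ∘ₗ rightHit f) g :=
      TensorProduct.ext' fun x y ↦ by simp [apply_rightHit]
    rw [this, sandwich_tmulDual, sandwich_tmulDual, ← rightHit_comp, LinearMap.comp_assoc]
  | add β γ hβ hγ => simp [LinearMap.add_comp, LinearMap.comp_add, hβ, hγ]

lemma sandwich_comp_rightHit (F : Module.End k H) (s : H →ₗ[k] k) (β : H ⊗[k] H →ₗ[k] k) :
    sandwich rightHit F β ∘ₗ rightHit s =
      sandwich rightHit F (β ∘ₗ (rightHit s).lTensor H) := by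
  induction β using dual_induction with
  | tmul f g =>
    have : tmulDual f g ∘ₗ (rightHit s).lTensor H = tmulDual f (g ∘ₗ rightHit s) :=
      TensorProduct.ext' fun x y ↦ by simp
    rw [this, sandwich_tmulDual, sandwich_tmulDual, ← rightHit_comp]
    simp only [LinearMap.comp_assoc]
  | add β γ hβ hγ => simp [LinearMap.add_comp, hβ, hγ]

lemma leftHit_comp_sandwich (F : Module.End k H) (s : H →ₗ[k] k) (β : H ⊗[k] H →ₗ[k] k) :
    leftHit s ∘ₗ sandwich leftHit F β =
      sandwich leftHit F (β ∘ₗ (rightHit s).rTensor H) := by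
  induction β using dual_induction with
  | tmul f g =>
    have : tmulDual f g ∘ₗ (rightHit s).rTensor H = tmulDual (s ∘ₗ leftHit f) g :=
      TensorProduct.ext' fun x y ↦ by simp [apply_rightHit]
    rw [this, sandwich_tmulDual, sandwich_tmulDual, ← leftHit_comp, LinearMap.comp_assoc]
  | add β γ hβ hγ => simp [LinearMap.add_comp, LinearMap.comp_add, hβ, hγ]

lemma sandwich_comp_leftHit (F : Module.End k H) (s : H →ₗ[k] k) (β : H ⊗[k] H →ₗ[k] k) :
    sandwich leftHit F β ∘ₗ leftHit s =
      sandwich leftHit F (β ∘ₗ (leftHit s).lTensor H) := by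
  induction β using dual_induction with
  | tmul f g =>
    have : tmulDual f g ∘ₗ (leftHit s).lTensor H = tmulDual f (g ∘ₗ leftHit s) :=
      TensorProduct.ext' fun x y ↦ by simp
    rw [this, sandwich_tmulDual, sandwich_tmulDual, ← leftHit_comp]
    simp only [LinearMap.comp_assoc]
  | add β γ hβ hγ => simp [LinearMap.add_comp, hβ, hγ]

lemma sandwich_comm {ρ : (H →ₗ[k] k) →ₗ[k] Module.End k H} {F G : Module.End k H}
    (hF : G ∘ₗ F = F ∘ₗ G) (hρ : ∀ f, G ∘ₗ ρ f = ρ f ∘ₗ G) (β : H ⊗[k] H →ₗ[k] k) :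
    G ∘ₗ sandwich ρ F β = sandwich ρ F β ∘ₗ G := by
  induction β using dual_induction with
  | tmul f g =>
    rw [sandwich_tmulDual, ← LinearMap.comp_assoc, hρ, LinearMap.comp_assoc,
      ← LinearMap.comp_assoc (ρ g) F G, hF, LinearMap.comp_assoc, hρ]
    simp only [LinearMap.comp_assoc]
  | add β γ hβ hγ => simp [LinearMap.add_comp, LinearMap.comp_add, hβ, hγ]

lemma sandwich_mem {ρ : (H →ₗ[k] k) →ₗ[k] Module.End k H} {F : Module.End k H}
    {V : Submodule k H} (hρ : ∀ f, ∀ x ∈ V, ρ f x ∈ V) (hF : ∀ x, F x ∈ V)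
    (β : H ⊗[k] H →ₗ[k] k) (x : H) : sandwich ρ F β x ∈ V := by
  induction β using dual_induction with
  | tmul f g => simpa [sandwich_tmulDual] using hρ _ _ (hF _)
  | add β γ hβ hγ => simpa using add_mem hβ hγ

lemma sandwich_apply_of_mem {ρ : (H →ₗ[k] k) →ₗ[k] Module.End k H} {F : Module.End k H}
    {V : Submodule k H} (hρ : ∀ f, ∀ x ∈ V, ρ f x ∈ V) (hF : ∀ x ∈ V, F x = x)
    (β : H ⊗[k] H →ₗ[k] k) {x : H} (hx : x ∈ V) :
    sandwich ρ F β x = sandwich ρ LinearMap.id β x := by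
  induction β using dual_induction with
  | tmul f g => simp [sandwich_tmulDual, hF _ (hρ g _ hx)]
  | add β γ hβ hγ => simp [hβ, hγ]

lemma sandwich_rightHit_id (β : H ⊗[k] H →ₗ[k] k) :
    sandwich rightHit LinearMap.id β = rightHit (β ∘ₗ comul) := by
  induction β using dual_induction with
  | tmul f g =>
    rw [sandwich_tmulDual, LinearMap.id_comp, rightHit_comp]
    congr 1
    ext x
    simp [rightHit_repr _ (ℛ k x), ← (ℛ k x).eq, mul_comm]
  | add β γ hβ hγ => simp [LinearMap.add_comp, hβ, hγ]

lemma sandwich_leftHit_id (β : H ⊗[k] H →ₗ[k] k) :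
    sandwich leftHit LinearMap.id β =
      leftHit (β ∘ₗ (TensorProduct.comm k H H).toLinearMap ∘ₗ comul) := by
  induction β using dual_induction with
  | tmul f g =>
    rw [sandwich_tmulDual, LinearMap.id_comp, leftHit_comp]
    congr 1
    ext x
    simp [leftHit_repr _ (ℛ k x), ← (ℛ k x).eq, mul_comm]
  | add β γ hβ hγ => simp [LinearMap.add_comp, hβ, hγ]

omit [FiniteDimensional k H] in
lemma IsDualIntegral.apply_leftHit_mul {l : H →ₗ[k] k} (hl : IsDualIntegral l)
    (s : H →ₗ[k] k) (u v : H) : l (leftHit s u * antipode k v) = l (u * antipode k (rightHit s v))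
        := by
  have h := congr(l (contractLeft s (comul u * $(sum_comul_antipode_mul (ℛ k v)))))
  rw [contractLeft_mul_right, ← leftHit_apply, Finset.mul_sum] at h
  rw [← h, rightHit_repr s (ℛ k v)]
  simp only [← mul_assoc, ← Bialgebra.comul_mul, map_sum]
  rw [Finset.mul_sum, map_sum]
  refine Finset.sum_congr rfl fun i _ ↦ ?_
  rw [← apply_contractRight, contractRight_mul_left, ← rightHit_apply, hl.rightHit_eq]
  simp [mul_comm]

omit [FiniteDimensional k H] in
lemma IsDualIntegral.apply_mul_rightHit {l : H →ₗ[k] k} (hl : IsDualIntegral l)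
    (s : H →ₗ[k] k) (u v : H) : l (antipode k v * rightHit s u) = l (antipode k (leftHit s v) * u)
        := by
  have h := congr(l (contractRight s ($(sum_mul_comul_antipode (ℛ k v)) * comul u)))
  rw [contractRight_left_mul, ← rightHit_apply, Finset.sum_mul] at h
  rw [← h, leftHit_repr s (ℛ k v)]
  simp only [mul_assoc, ← Bialgebra.comul_mul, map_sum]
  rw [Finset.sum_mul, map_sum]
  refine Finset.sum_congr rfl fun i _ ↦ ?_
  rw [apply_contractRight, contractLeft_right_mul, ← leftHit_apply, hl.leftHit_eq]
  simp [mul_comm]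

theorem IsDualIntegral.exists_isCompl {l : H →ₗ[k] k} (hl : IsDualIntegral l)
    {V : Submodule k H} (hV : IsSubcoalgebra k V) :
    ∃ W : Submodule k H, IsSubcoalgebra k W ∧ IsCompl V W := by
  rw [isSubcoalgebra_iff] at hV
  obtain ⟨π, hπ⟩ := LinearMap.exists_leftInverse_of_injective V.subtype V.ker_subtype
  let F : H →ₗ[k] H := V.subtype ∘ₗ π
  have hFV (x) : F x ∈ V := (π x).2
  have hF (v) (hv : v ∈ V) : F v = v :=
    congrArg Subtype.val (LinearMap.congr_fun hπ ⟨v, hv⟩)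
  let β : H ⊗[k] H →ₗ[k] k := l ∘ₗ LinearMap.mul' k H ∘ₗ (antipode k (A := H)).lTensor H
  let A := sandwich rightHit F β
  have hAV := sandwich_mem (fun f x hx ↦ (hV f x hx).1) hFV β
  have hA (x) (hx : x ∈ V) : A x = x := by
    have : β ∘ₗ comul = counit := by
      ext x
      have := congr(l $(sum_mul_antipode_eq_smul (ℛ k x)))
      simp only [map_smul, map_sum] at this
      simp [β, ← (ℛ k x).eq, this, hl.map_one]
    rw [sandwich_apply_of_mem (fun f x hx ↦ (hV f x hx).1) hF β hx, sandwich_rightHit_id, this]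
    simp
  have hAr (s : H →ₗ[k] k) : rightHit s ∘ₗ A = A ∘ₗ rightHit s := by
    rw [rightHit_comp_sandwich, sandwich_comp_rightHit]
    congr 1
    exact TensorProduct.ext' fun x y ↦ by simp [β, hl.apply_leftHit_mul]
  let γ : H ⊗[k] H →ₗ[k] k :=
    l ∘ₗ LinearMap.mul' k H ∘ₗ (antipode k (A := H)).rTensor H ∘ₗ
        (TensorProduct.comm k H H).toLinearMap
  let B := sandwich leftHit A γ
  have hBV := sandwich_mem (fun f x hx ↦ (hV f x hx).2) hAV γ
  have hB (x) (hx : x ∈ V) : B x = x := by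
    have : γ ∘ₗ (TensorProduct.comm k H H).toLinearMap ∘ₗ comul = counit := by
      ext x
      have := congr(l $(sum_antipode_mul_eq_smul (ℛ k x)))
      simp only [map_smul, map_sum] at this
      simp [γ, ← (ℛ k x).eq, this, hl.map_one]
    rw [sandwich_apply_of_mem (fun f x hx ↦ (hV f x hx).2) hA γ hx, sandwich_leftHit_id, this]
    simp
  have hBl (s : H →ₗ[k] k) : leftHit s ∘ₗ B = B ∘ₗ leftHit s := by
    rw [leftHit_comp_sandwich, sandwich_comp_leftHit]
    congr 1
    exact TensorProduct.ext' fun x y ↦ by simp [γ, hl.apply_mul_rightHit]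
  have hBr (s : H →ₗ[k] k) : rightHit s ∘ₗ B = B ∘ₗ rightHit s :=
    sandwich_comm (hAr s) (rightHit_leftHit_comm s) γ
  refine ⟨LinearMap.ker B, isSubcoalgebra_iff.2 fun f x hx ↦ ?_, ?_⟩
  · rw [LinearMap.mem_ker] at hx
    constructor
    · rw [LinearMap.mem_ker, ← LinearMap.comp_apply, ← hBr, LinearMap.comp_apply, hx, map_zero]
    · rw [LinearMap.mem_ker, ← LinearMap.comp_apply, ← hBl, LinearMap.comp_apply, hx, map_zero]
  · have := LinearMap.isCompl_of_proj (f := B.codRestrict V hBV) fun x ↦ Subtype.ext (hB x x.2)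
    rwa [LinearMap.ker_codRestrict] at this

omit [FiniteDimensional k H] in
lemma isSubcoalgebra_sSup {s : Set (Submodule k H)} (hs : ∀ V ∈ s, IsSubcoalgebra k V) :
    IsSubcoalgebra k (sSup s) := by
  refine isSubcoalgebra_iff.2 fun f x hx ↦ ?_
  have h1 : sSup s ≤ (sSup s).comap (rightHit f) := sSup_le fun V hV x hx ↦
    le_sSup hV (isSubcoalgebra_iff.1 (hs V hV) f x hx).1
  have h2 : sSup s ≤ (sSup s).comap (leftHit f) := sSup_le fun V hV x hx ↦
    le_sSup hV (isSubcoalgebra_iff.1 (hs V hV) f x hx).2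
  exact ⟨h1 hx, h2 hx⟩

theorem IsDualIntegral.isCosemisimple {l : H →ₗ[k] k} (hl : IsDualIntegral l) :
    IsCosemisimple k H := by
  set s := {V : Submodule k H | IsSubcoalgebra k V ∧ V ≠ ⊥ ∧
    ∀ W ≤ V, IsSubcoalgebra k W → W = ⊥ ∨ W = V} with hs
  change sSup s = ⊤
  obtain ⟨W, hW, hc⟩ := hl.exists_isCompl (isSubcoalgebra_sSup (s := s) fun V hV ↦ hV.1)
  by_cases h : W = ⊥
  · rw [h] at hc
    simpa using hc.sup_eq_top
  obtain ⟨V, ⟨hV, hV0, hVW⟩, hmin⟩ := wellFounded_lt.has_min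
    {V : Submodule k H | IsSubcoalgebra k V ∧ V ≠ ⊥ ∧ V ≤ W} ⟨W, hW, h, le_rfl⟩
  have : V ∈ s := ⟨hV, hV0, fun U hU hUc ↦ by
    by_contra! hne
    exact hmin U ⟨hUc, hne.1, hU.trans hVW⟩ (lt_of_le_of_ne hU hne.2)⟩
  exact (hV0 (disjoint_self.1 (hc.disjoint.mono (le_sSup this) hVW))).elim

omit [FiniteDimensional k H] in
lemma exists_left_integral {R : Type*} [Ring R] [Algebra k R] [IsSemisimpleRing R]
    (ε : R →ₐ[k] k) : ∃ Λ : R, (∀ h, h * Λ = ε h • Λ) ∧ ε Λ = 1 := by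
  obtain ⟨J, hJ⟩ := exists_isCompl (RingHom.ker ε : Submodule R R)
  obtain ⟨i, hi, Λ, hΛ, h1⟩ := Submodule.mem_sup.1
    (hJ.sup_eq_top ▸ Submodule.mem_top : (1 : R) ∈ RingHom.ker ε ⊔ J)
  have hε : ε Λ = 1 := by
    rw [RingHom.mem_ker] at hi
    simpa [hi] using congrArg ε h1
  refine ⟨Λ, fun h ↦ ?_, hε⟩
  rw [← sub_eq_zero]
  refine Submodule.disjoint_def.1 hJ.disjoint _ (by simp [RingHom.mem_ker, hε]) ?_
  rw [← algebraMap_smul R (ε h) Λ]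
  exact sub_mem (J.smul_mem h hΛ) (J.smul_mem _ hΛ)

/-- A normalized two-sided integral of a Hopf algebra. -/
structure IsIntegral (k : Type*) {H : Type*} [Field k] [Ring H] [HopfAlgebra k H] (Λ : H) :
    Prop where
  mul_eq : ∀ h, h * Λ = counit (R := k) h • Λ
  eq_mul : ∀ h, Λ * h = counit (R := k) h • Λ
  counit_eq : counit (R := k) Λ = 1

omit [FiniteDimensional k H] in
theorem exists_isIntegral [IsSemisimpleRing H] : ∃ Λ : H, IsIntegral k Λ := by
  obtain ⟨Λ, hΛ, h1⟩ := exists_left_integral (Bialgebra.counitAlgHom k H)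
  obtain ⟨Λ', hΛ', h1'⟩ := exists_left_integral
    ((Bialgebra.counitAlgHom k H).fromOpposite fun x y ↦ mul_comm _ _)
  have h2 (h : H) : Λ'.unop * h = counit (R := k) h • Λ'.unop :=
    congrArg MulOpposite.unop (hΛ' (MulOpposite.op h))
  have h3 : counit (R := k) Λ'.unop = 1 := h1'
  have h4 : Λ = Λ'.unop := by
    have := hΛ Λ'.unop
    rw [h2] at this
    simp_all
  exact ⟨Λ, hΛ, fun h ↦ h4 ▸ h2 h, h1⟩

omit [FiniteDimensional k H] in
lemma isSubcoalgebra_sup {V W : Submodule k H} (hV : IsSubcoalgebra k V)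
    (hW : IsSubcoalgebra k W) : IsSubcoalgebra k (V ⊔ W) := by
  rw [← sSup_pair]
  refine isSubcoalgebra_sSup ?_
  rintro _ (rfl | rfl) <;> assumption

theorem exists_isDualIntegral (hH : IsCosemisimple k H) :
    ∃ l : H →ₗ[k] k, IsDualIntegral l := by
  have h1r (f : H →ₗ[k] k) : rightHit f 1 = f 1 • (1 : H) := by
    simp [rightHit_apply, Algebra.TensorProduct.one_def]
  have h1l (f : H →ₗ[k] k) : leftHit f 1 = f 1 • (1 : H) := by
    simp [leftHit_apply, Algebra.TensorProduct.one_def]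
  have hU : IsSubcoalgebra k (Submodule.span k {(1 : H)}) := by
    refine isSubcoalgebra_iff.2 fun f x hx ↦ ?_
    obtain ⟨a, rfl⟩ := Submodule.mem_span_singleton.1 hx
    simp only [map_smul, h1r, h1l, and_self]
    exact Submodule.smul_mem _ _ (Submodule.smul_mem _ _ (Submodule.mem_span_singleton_self _))
  have h10 : (1 : H) ≠ 0 := fun h ↦ by
    simpa using congrArg (counit (R := k)) h
  obtain ⟨D, ⟨hD, hD1⟩, hmax⟩ := wellFounded_gt.has_min
    {V : Submodule k H | IsSubcoalgebra k V ∧ (1 : H) ∉ V}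
    ⟨⊥, isSubcoalgebra_iff.2 fun f x hx ↦ by simp_all, by simpa⟩
  have htop : D ⊔ Submodule.span k {(1 : H)} = ⊤ := by
    rw [eq_top_iff, ← (hH : sSup _ = _)]
    refine sSup_le fun C hC ↦ ?_
    obtain ⟨hC, hC0, hCmin⟩ := hC
    have hDU := isSubcoalgebra_sup hD hU
    have hinf : IsSubcoalgebra k (C ⊓ (D ⊔ Submodule.span k {(1 : H)})) :=
      isSubcoalgebra_iff.2 fun f x hx ↦
        ⟨⟨(isSubcoalgebra_iff.1 hC f x hx.1).1, (isSubcoalgebra_iff.1 hDU f x hx.2).1⟩,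
          (isSubcoalgebra_iff.1 hC f x hx.1).2, (isSubcoalgebra_iff.1 hDU f x hx.2).2⟩
    rcases hCmin _ inf_le_left hinf with h | h
    · exfalso
      refine hmax (D ⊔ C) ⟨isSubcoalgebra_sup hD hC, fun h1 ↦ ?_⟩ ?_
      · obtain ⟨d, hd, c, hc, hdc⟩ := Submodule.mem_sup.1 h1
        have hc0 : c ∈ C ⊓ (D ⊔ Submodule.span k {(1 : H)}) := by
          refine ⟨hc, ?_⟩
          rw [eq_sub_of_add_eq' hdc]
          exact sub_mem (Submodule.mem_sup_right (Submodule.mem_span_singleton_self _))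
            (Submodule.mem_sup_left hd)
        rw [h, Submodule.mem_bot] at hc0
        rw [hc0, add_zero] at hdc
        exact hD1 (hdc ▸ hd)
      · refine lt_of_le_of_ne le_sup_left fun hDC ↦ hC0 ?_
        rw [eq_bot_iff, ← h]
        exact le_inf le_rfl ((sup_eq_left.1 hDC.symm).trans le_sup_left)
    · exact inf_eq_left.1 h
  obtain ⟨f, hf1, hfD⟩ := Submodule.exists_le_ker_of_notMem hD1
  let l := (f 1)⁻¹ • f
  have hl1 : l 1 = 1 := by simp [l, hf1]
  have hlD (d) (hd : d ∈ D) : l d = 0 := by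
    have : f d = 0 := hfD hd
    simp [l, this]
  have hext (x : H) : ∃ d ∈ D, ∃ a : k, d + a • 1 = x := by
    obtain ⟨d, hd, u, hu, h⟩ := Submodule.mem_sup.1 (htop ▸ Submodule.mem_top : x ∈ _)
    obtain ⟨a, rfl⟩ := Submodule.mem_span_singleton.1 hu
    exact ⟨d, hd, a, h⟩
  refine ⟨l, fun x ↦ ?_, fun x ↦ ?_, hl1⟩
  · obtain ⟨d, hd, a, rfl⟩ := hext x
    have : leftHit l d = 0 := eq_of_forall_dual fun f ↦ by
      rw [← apply_rightHit, hlD _ (isSubcoalgebra_iff.1 hD f d hd).1, map_zero]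
    simp [this, hlD d hd, h1l, hl1]
  · obtain ⟨d, hd, a, rfl⟩ := hext x
    have : rightHit l d = 0 := eq_of_forall_dual fun f ↦ by
      rw [apply_rightHit, hlD _ (isSubcoalgebra_iff.1 hD f d hd).2, map_zero]
    simp [this, hlD d hd, h1r, hl1]

omit [FiniteDimensional k H] in
lemma comul_antipode_antipode (x : H) :
    comul (R := k) (antipode k (antipode k x)) = TensorProduct.map (antipode k (A := H) ∘ₗ
        antipode k (A := H)) (antipode k (A := H) ∘ₗ antipode k (A := H)) (comul x) := by
  rw [comul_antipode, comul_antipode, ← (ℛ k x).eq]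
  simp

omit [FiniteDimensional k H] in
lemma antipode_antipode_mul (x y : H) : antipode k (antipode k (x * y)) = antipode k (antipode k x)
    * antipode k (antipode k y) := by
  simp [antipode_mul_antidistrib]

omit [FiniteDimensional k H] in
lemma IsIntegral.comul_mul_left {Λ : H} (hΛ : IsIntegral k Λ) (h : H) :
    comul (R := k) Λ * (h ⊗ₜ 1) = comul Λ * (1 ⊗ₜ antipode k h) := by
  rw [← sum_comul_mul_antipode (ℛ k h), Finset.mul_sum]
  simp only [← mul_assoc, ← Bialgebra.comul_mul, hΛ.eq_mul, map_smul]
  simp only [smul_mul_assoc, ← mul_smul_comm, ← Finset.mul_sum]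
  congr 1
  have := congr((1 : H) ⊗ₜ[k] antipode k ($(leftHit_counit (k := k) (H := H)) h))
  rw [leftHit_repr _ (ℛ k h), map_sum, TensorProduct.tmul_sum] at this
  simpa using this

omit [FiniteDimensional k H] in
lemma IsIntegral.mul_comul_right {Λ : H} (hΛ : IsIntegral k Λ) (h : H) :
    (1 ⊗ₜ h) * comul (R := k) Λ = (antipode k h ⊗ₜ 1) * comul Λ := by
  rw [← sum_antipode_mul_comul (ℛ k h), Finset.sum_mul]
  simp only [mul_assoc, ← Bialgebra.comul_mul, hΛ.mul_eq, map_smul]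
  simp only [mul_smul_comm, ← smul_mul_assoc, ← Finset.sum_mul]
  congr 1
  have := congr(antipode k ($(rightHit_counit (k := k) (H := H)) h) ⊗ₜ[k] (1 : H))
  rw [rightHit_repr _ (ℛ k h), map_sum, TensorProduct.sum_tmul] at this
  simpa [TensorProduct.smul_tmul'] using this

section Integrals

variable {Λ : H} {l : H →ₗ[k] k}

omit [FiniteDimensional k H] in
lemma contractLeft_comul_mul_left (hΛ : IsIntegral k Λ) (hl : IsDualIntegral l) (h : H) :
    contractLeft l (comul Λ * (h ⊗ₜ 1)) = l Λ • antipode k h := by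
  rw [hΛ.comul_mul_left, contractLeft_mul_right, ← leftHit_apply, hl.leftHit_eq, smul_one_mul]

omit [FiniteDimensional k H] in
lemma contractRight_right_mul_comul (hΛ : IsIntegral k Λ) (hl : IsDualIntegral l) (h : H) :
    contractRight l ((1 ⊗ₜ h) * comul Λ) = l Λ • antipode k h := by
  rw [hΛ.mul_comul_right, contractRight_left_mul, ← rightHit_apply, hl.rightHit_eq, mul_smul_one]

omit [FiniteDimensional k H] in
lemma contractRight_comul_mul_left (hl : IsDualIntegral l) (h : H) :
    contractRight l (comul Λ * (h ⊗ₜ 1)) = l Λ • h := by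
  rw [contractRight_mul_left, ← rightHit_apply, hl.rightHit_eq, smul_one_mul]

lemma traceMulRight_eq (hl : IsDualIntegral l) (x : H) :
    traceMulRight x = LinearMap.trace k H (antipode k (A := H) ∘ₗ antipode k (A := H)) * l x := by
  have h := apply_rightHit (traceMulRight (k := k)) l x
  have h1 : traceMulRight (k := k) (1 : H) = LinearMap.trace k H (antipode k (A := H) ∘ₗ
      antipode k (A := H)) := by
    simp [traceMulRight]
  simpa [hl.rightHit_eq, leftHit_traceMulRight, hl.map_one, h1, mul_comm] using h.symm

lemma trace_mul_apply_eq_one (hΛ : IsIntegral k Λ) (hl : IsDualIntegral l) :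
    LinearMap.trace k H (antipode k (A := H) ∘ₗ antipode k (A := H)) * l Λ = 1 := by
  rw [← traceMulRight_eq hl]
  have : LinearMap.mulRight k Λ ∘ₗ antipode k (A := H) ∘ₗ antipode k (A := H) =
      counit.smulRight Λ := by
    ext x
    simp [hΛ.mul_eq]
  rw [traceMulRight, LinearMap.coe_mk, AddHom.coe_mk, this, LinearMap.trace_smulRight,
    hΛ.counit_eq]

variable (hΛ : IsIntegral k Λ) (hl : IsDualIntegral l)
include hΛ hl

lemma apply_integral_ne_zero : l Λ ≠ 0 :=
  right_ne_zero_of_mul_eq_one (trace_mul_apply_eq_one hΛ hl)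

lemma antipode_injective : Function.Injective (antipode k (A := H)) := by
  rw [← LinearMap.ker_eq_bot, LinearMap.ker_eq_bot']
  intro h hh
  have := contractRight_comul_mul_left (Λ := Λ) hl h
  rw [hΛ.comul_mul_left, hh] at this
  simpa [apply_integral_ne_zero hΛ hl] using this.symm

lemma antipode_surjective : Function.Surjective (antipode k (A := H)) :=
  LinearMap.injective_iff_surjective.1 (antipode_injective hΛ hl)

lemma apply_antipode (h : H) : l (antipode k h) = l h := by
  have := apply_contractRight l l (comul Λ * (h ⊗ₜ 1))
  rw [contractLeft_comul_mul_left hΛ hl, contractRight_comul_mul_left hl] at this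
  simpa [apply_integral_ne_zero hΛ hl] using this.symm

lemma apply_mul_comm (h x : H) : l (h * x) = l (x * antipode k (antipode k h)) := by
  obtain ⟨u, rfl⟩ := antipode_surjective hΛ hl x
  have key (f : H →ₗ[k] k) : l (contractRight f (comul Λ) * u) = l Λ * f (antipode k u) := by
    rw [← contractRight_mul_left, apply_contractRight, contractLeft_comul_mul_left hΛ hl,
      map_smul, smul_eq_mul]
  have h1 : contractRight (l ∘ₗ LinearMap.mulLeft k h) (comul Λ) = l Λ • antipode k h := by
    rw [contractRight_comp_mulLeft, contractRight_right_mul_comul hΛ hl]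
  have h2 : contractRight (l ∘ₗ LinearMap.mulRight k (antipode k (antipode k h))) (comul Λ) =
      l Λ • antipode k h := by
    rw [contractRight_comp_mulRight, ← hΛ.comul_mul_left, contractRight_comul_mul_left hl]
  have h3 := (key (l ∘ₗ LinearMap.mulLeft k h)).symm
  rw [h1, ← h2, key] at h3
  simpa [apply_integral_ne_zero hΛ hl] using h3

lemma eq_zero_of_apply_mul {x : H} (h : ∀ y, l (y * x) = 0) : x = 0 := by
  obtain ⟨u, rfl⟩ := antipode_surjective hΛ hl x
  have h1 := contractRight_comul_mul_left (Λ := Λ) hl u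
  have h2 : l ∘ₗ LinearMap.mulRight k (antipode k u) = 0 := by
    ext y
    simpa using h y
  rw [hΛ.comul_mul_left, ← contractRight_comp_mulRight, h2] at h1
  have h3 : u = 0 := by simpa [apply_integral_ne_zero hΛ hl] using h1.symm
  simp [h3]

theorem antipode_pow_four (x : H) : antipode k (antipode k (antipode k (antipode k x))) = x := by
  rw [← sub_eq_zero]
  refine eq_zero_of_apply_mul hΛ hl fun y ↦ ?_
  rw [mul_sub, map_sub, sub_eq_zero, ← apply_mul_comm hΛ hl, ← apply_antipode hΛ hl,
    antipode_mul_antidistrib, ← apply_mul_comm hΛ hl, ← antipode_mul_antidistrib,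
    apply_antipode hΛ hl]

end Integrals

lemma exists_trace_rightHit : ∃ X : H, ∀ p : H →ₗ[k] k,
    p X = LinearMap.trace k H (rightHit p) := by
  obtain ⟨X, hX⟩ := (Module.evalEquiv k H).surjective (LinearMap.trace k H ∘ₗ rightHit)
  exact ⟨X, fun p ↦ congr($hX p)⟩

omit [FiniteDimensional k H] in
lemma contractRight_mul {ι : Type*} [Fintype ι] {p : H →ₗ[k] k} {q r : ι → H →ₗ[k] k}
    (hp : p ∘ₗ LinearMap.mul' k H = ∑ i, tmulDual (q i) (r i)) (s t : H ⊗[k] H) :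
    contractRight p (s * t) = ∑ i, contractRight (q i) s * contractRight (r i) t := by
  induction s with
  | zero => simp
  | add s u hs hu => simp [add_mul, hs, hu, Finset.sum_add_distrib]
  | tmul a b =>
    induction t with
    | zero => simp
    | add s u hs hu => simp only [mul_add, map_add, hs, hu, Finset.sum_add_distrib]
    | tmul c d =>
      have := congr($hp (b ⊗ₜ d))
      simp only [LinearMap.comp_apply, LinearMap.mul'_apply, LinearMap.sum_apply,
        tmulDual_tmul] at this
      simp [this, Finset.sum_smul, smul_smul, mul_comm]

theorem mul_self_of_trace_rightHit {X : H}
    (hX : ∀ p : H →ₗ[k] k, p X = LinearMap.trace k H (rightHit p)) :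
    X * X = (Module.finrank k H : k) • X := by
  refine eq_of_forall_dual fun (p : H →ₗ[k] k) ↦ ?_
  obtain ⟨n, q, r, hp⟩ := exists_sum_mul (p ∘ₗ LinearMap.mul' k H)
  let T : Module.End k (H ⊗[k] H) := ∑ i, TensorProduct.map (rightHit (q i)) (rightHit (r i))
  have h1 : p (X * X) = LinearMap.trace k (H ⊗[k] H) T := by
    have := congr($hp (X ⊗ₜ X))
    simp only [LinearMap.comp_apply, LinearMap.mul'_apply, LinearMap.sum_apply,
      tmulDual_tmul, hX (q _), hX (r _)] at this
    simp [this, T, LinearMap.trace_tensorProduct']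
  let Φ : Module.End k (H ⊗[k] H) :=
    (LinearMap.mul' k H).lTensor H ∘ₗ (TensorProduct.assoc k H H H).toLinearMap ∘ₗ
      (comul (R := k)).rTensor H
  have hΦ (y z : H) : Φ (y ⊗ₜ z) = comul y * (1 ⊗ₜ z) := by
    simp [Φ, ← (ℛ k y).eq, TensorProduct.sum_tmul, Finset.sum_mul]
  let Ψ : Module.End k (H ⊗[k] H) :=
    (LinearMap.mul' k H).lTensor H ∘ₗ (TensorProduct.assoc k H H H).toLinearMap ∘ₗ
      ((antipode k (A := H)).lTensor H ∘ₗ comul (R := k)).rTensor H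
  have hΨ (y z : H) : Ψ (y ⊗ₜ z) = ∑ i ∈ (ℛ k y).index,
      (ℛ k y).left i ⊗ₜ (antipode k ((ℛ k y).right i) * z) := by
    simp [Ψ, ← (ℛ k y).eq, TensorProduct.sum_tmul]
  have hΦΨ : Φ ∘ₗ Ψ = LinearMap.id := by
    refine TensorProduct.ext' fun y z ↦ ?_
    have := congr($(sum_comul_mul_antipode (ℛ k y)) * (1 ⊗ₜ z))
    simpa [hΨ, hΦ, Finset.sum_mul, mul_assoc] using this
  have hΨΦ : Ψ ∘ₗ Φ = LinearMap.id := (LinearMap.comp_eq_id_comm _ _).1 hΦΨ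
  have hT : Φ ∘ₗ T = (rightHit p).lTensor H ∘ₗ Φ := by
    refine TensorProduct.ext' fun y z ↦ ?_
    have h (t : H ⊗[k] H) : (rightHit p).lTensor H (t * (1 ⊗ₜ z)) =
        ∑ i, (rightHit (q i)).lTensor H t * (1 ⊗ₜ rightHit (r i) z) := by
      induction t with
      | zero => simp
      | add s u hs hu => simp [add_mul, hs, hu, Finset.sum_add_distrib]
      | tmul a b =>
        simp [rightHit_apply, contractRight_mul hp, TensorProduct.tmul_sum]
    simp [T, hΦ, h, comul_rightHit]
  rw [h1, map_smul, hX p]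
  calc LinearMap.trace k _ T = LinearMap.trace k _ ((T ∘ₗ Ψ) ∘ₗ Φ) := by
        rw [LinearMap.comp_assoc, hΨΦ, LinearMap.comp_id]
    _ = LinearMap.trace k _ (Φ ∘ₗ T ∘ₗ Ψ) := LinearMap.trace_comp_comm' _ _
    _ = LinearMap.trace k _ ((rightHit p).lTensor H) := by
        rw [← LinearMap.comp_assoc, hT, LinearMap.comp_assoc, hΦΨ, LinearMap.comp_id]
    _ = _ := by
        rw [LinearMap.lTensor, LinearMap.trace_tensorProduct', LinearMap.trace_id, smul_eq_mul]

lemma antipode_antipode_of_trace_rightHit (h4 : ∀ x : H,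
    antipode k (antipode k (antipode k (antipode k x))) = x) {X : H}
    (hX : ∀ p : H →ₗ[k] k, p X = LinearMap.trace k H (rightHit p)) :
        antipode k (antipode k (A := H) X) = X := by
  refine eq_of_forall_dual fun (p : H →ₗ[k] k) ↦ ?_
  have h := hX (p ∘ₗ antipode k (A := H) ∘ₗ antipode k (A := H))
  have h1 : (antipode k (A := H) ∘ₗ antipode k (A := H)) ∘ₗ
      rightHit (p ∘ₗ antipode k (A := H) ∘ₗ antipode k (A := H)) = rightHit p ∘ₗ antipode k (A := H)
      ∘ₗ antipode k (A := H) := by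
    ext x
    simp only [LinearMap.comp_apply, rightHit_apply, comul_antipode_antipode]
    simp [← (ℛ k x).eq]
  have h2 : rightHit (p ∘ₗ antipode k (A := H) ∘ₗ antipode k (A := H)) =
      (antipode k (A := H) ∘ₗ antipode k (A := H)) ∘ₗ rightHit p ∘ₗ antipode k (A := H) ∘ₗ
      antipode k (A := H) := by
    rw [← h1]
    ext x
    simp [h4]
  have h3 : (rightHit p ∘ₗ antipode k (A := H) ∘ₗ antipode k (A := H)) ∘ₗ antipode k (A := H) ∘ₗ
      antipode k (A := H) = rightHit p := by
    ext x
    simp [h4]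
  rw [h2, LinearMap.trace_comp_comm', h3, ← hX] at h
  exact h

lemma apply_trace_rightHit {l : H →ₗ[k] k} (hl : IsDualIntegral l) {X : H}
    (hX : ∀ p : H →ₗ[k] k, p X = LinearMap.trace k H (rightHit p)) : l X = 1 := by
  have : rightHit l = l.smulRight (1 : H) := by
    ext x
    simp [hl.rightHit_eq]
  rw [hX, this, LinearMap.trace_smulRight, hl.map_one]

end FiniteDimensional

end Hopf

section Involution

variable {k V : Type*} [Field k] [AddCommGroup V] [Module k V] [FiniteDimensional k V]

lemma trace_eq_finrank_range {P : Module.End k V} (hP : P ∘ₗ P = P) :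
    LinearMap.trace k V P = (Module.finrank k (LinearMap.range P) : k) :=
  LinearMap.IsProj.trace ⟨fun x ↦ ⟨x, rfl⟩, by rintro _ ⟨x, rfl⟩; exact LinearMap.congr_fun hP x⟩

lemma eq_id_of_finrank_range {P : Module.End k V} (hP : P ∘ₗ P = P)
    (h : Module.finrank k (LinearMap.range P) = Module.finrank k V) : P = LinearMap.id := by
  ext x
  obtain ⟨y, rfl⟩ := LinearMap.range_eq_top.1 (Submodule.eq_top_of_finrank_eq h) x
  exact LinearMap.congr_fun hP y

/-- An endomorphism with `E³ = E` has an integral trace of absolute value at most the dimension,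
with equality only for `± id`. -/
theorem exists_int_trace_of_cube (h2 : (2 : k) ≠ 0) {E : Module.End k V}
    (hE : E ∘ₗ E ∘ₗ E = E) : ∃ m : ℤ, LinearMap.trace k V E = m ∧
      |m| ≤ Module.finrank k V ∧
        (|m| = Module.finrank k V → E = LinearMap.id ∨ E = -LinearMap.id) := by
  let P : Module.End k V := (2 : k)⁻¹ • (E ∘ₗ E + E)
  let Q : Module.End k V := (2 : k)⁻¹ • (E ∘ₗ E - E)
  have h3 (x) : E (E (E x)) = E x := LinearMap.congr_fun hE x
  have hP : P ∘ₗ P = P := by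
    ext x
    simp only [P, LinearMap.comp_apply, LinearMap.smul_apply, LinearMap.add_apply, map_smul,
      map_add, h3]
    match_scalars <;> field_simp <;> norm_num
  have hQ : Q ∘ₗ Q = Q := by
    ext x
    simp only [Q, LinearMap.comp_apply, LinearMap.smul_apply, LinearMap.sub_apply, map_smul,
      map_sub, h3]
    match_scalars <;> field_simp <;> norm_num
  have hPQ : P ∘ₗ Q = 0 := by
    ext x
    simp only [P, Q, LinearMap.comp_apply, LinearMap.smul_apply, LinearMap.sub_apply, map_smul,
      map_sub, h3, LinearMap.add_apply, LinearMap.zero_apply]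
    match_scalars <;> field_simp <;> norm_num
  have hE' : E = P - Q := by
    ext x
    simp only [P, Q, LinearMap.comp_apply, LinearMap.smul_apply, LinearMap.sub_apply,
      LinearMap.add_apply]
    match_scalars <;> field_simp <;> norm_num
  have hle : Module.finrank k (LinearMap.range P) + Module.finrank k (LinearMap.range Q) ≤
      Module.finrank k V := by
    have h1 : LinearMap.range Q ≤ LinearMap.ker P := by
      rintro _ ⟨x, rfl⟩
      exact LinearMap.congr_fun hPQ x
    have := Submodule.finrank_mono h1
    have := LinearMap.finrank_range_add_finrank_ker P
    omega
  refine ⟨Module.finrank k (LinearMap.range P) - Module.finrank k (LinearMap.range Q), ?_, ?_, ?_⟩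
  · conv_lhs => rw [hE']
    rw [map_sub, trace_eq_finrank_range hP, trace_eq_finrank_range hQ]
    push_cast
    rfl
  · rw [abs_le]
    constructor <;> omega
  · intro h
    rcases abs_choice ((Module.finrank k (LinearMap.range P) : ℤ) -
      Module.finrank k (LinearMap.range Q)) with h' | h' <;> rw [h'] at h
    · left
      have hp := eq_id_of_finrank_range hP (by omega)
      have hq : Q = 0 := by rw [hp] at hPQ; simpa using hPQ
      rw [hE', hp, hq, sub_zero]
    · right
      have hq := eq_id_of_finrank_range hQ (by omega)
      have hp : P = 0 := by rw [hq] at hPQ; simpa using hPQ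
      rw [hE', hp, hq, zero_sub]

end Involution

section Hopf

variable {k H : Type*} [Field k] [Ring H] [HopfAlgebra k H] [FiniteDimensional k H]

lemma trace_antipode_sq_ne_zero [IsSemisimpleRing H] (hH : IsCosemisimple k H) :
    LinearMap.trace k H (antipode k (A := H) ∘ₗ antipode k (A := H)) ≠ 0 := by
  obtain ⟨Λ, hΛ⟩ := exists_isIntegral (k := k) (H := H)
  obtain ⟨l, hl⟩ := exists_isDualIntegral hH
  exact left_ne_zero_of_mul_eq_one (trace_mul_apply_eq_one hΛ hl)

lemma intCast_inj_of_abs_sub_lt {R : Type*} [Field R] {a b : ℤ} (h : (a : R) = b)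
    (hab : |a - b| < ringChar R) : a = b := by
  have := (CharP.intCast_eq_zero_iff R (ringChar R) (a - b)).1 (by simp [h])
  exact sub_eq_zero.1 (Int.eq_zero_of_abs_lt_dvd this hab)

theorem antipode_sq_eq_id [IsSemisimpleRing H] (hH : IsCosemisimple k H)
    (hchar : (Module.finrank k H) ^ 2 < ringChar k) :
    antipode k (A := H) ∘ₗ antipode k (A := H) = LinearMap.id := by
  obtain ⟨Λ, hΛ⟩ := exists_isIntegral (k := k) (H := H)
  obtain ⟨l, hl⟩ := exists_isDualIntegral hH
  have ht := trace_antipode_sq_ne_zero hH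
  have h4 := antipode_pow_four hΛ hl
  have h10 : (1 : H) ≠ 0 := fun h ↦ by
    simpa using congrArg (counit (R := k)) h
  have hnt : Nontrivial H := ⟨1, 0, h10⟩
  have hn0 : 0 < Module.finrank k H := Module.finrank_pos
  rcases Nat.lt_or_ge 1 (Module.finrank k H) with hn | hn
  · have hcast (j : ℕ) (hj0 : 0 < j) (hj : j < ringChar k) : (j : k) ≠ 0 := fun h ↦
      (Nat.le_of_dvd hj0 (ringChar.dvd h)).not_gt hj
    have h2 : (2 : k) ≠ 0 := by
      exact_mod_cast hcast 2 (by norm_num) (by nlinarith)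
    have hnk : (Module.finrank k H : k) ≠ 0 := hcast _ hn0 (by nlinarith)
    obtain ⟨X, hX⟩ := exists_trace_rightHit (k := k) (H := H)
    have hXX := mul_self_of_trace_rightHit hX
    have hSX := antipode_antipode_of_trace_rightHit h4 hX
    have hlX := apply_trace_rightHit hl hX
    obtain ⟨a, hta, ha, ha'⟩ := exists_int_trace_of_cube h2
      (E := antipode k (A := H) ∘ₗ antipode k (A := H)) (by ext x; simp [h4])
    obtain ⟨m, htm, hm, hm'⟩ := exists_int_trace_of_cube h2
      (E := (Module.finrank k H : k)⁻¹ •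
        (LinearMap.mulRight k X ∘ₗ antipode k (A := H) ∘ₗ antipode k (A := H)))
      (by
        ext x
        simp [antipode_antipode_mul, hSX, h4, mul_assoc, hXX, hnk])
    have hG : LinearMap.trace k H
        (LinearMap.mulRight k X ∘ₗ antipode k (A := H) ∘ₗ antipode k (A := H)) = a := by
      have := traceMulRight_eq hl X
      rw [hlX, mul_one, hta] at this
      exact this
    rw [map_smul, hG, smul_eq_mul, inv_mul_eq_iff_eq_mul₀ hnk] at htm
    have hmn : |m| ≠ Module.finrank k H := fun h ↦ by
      have hX1 : X = (Module.finrank k H : k) • (1 : H) ∨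
          X = -((Module.finrank k H : k) • (1 : H)) := by
        refine (hm' h).imp (fun h' ↦ ?_) fun h' ↦ ?_ <;> have h1 := LinearMap.congr_fun h' 1
        · simpa [inv_smul_eq_iff₀ hnk] using h1
        · simpa [inv_smul_eq_iff₀ hnk] using h1
      rcases hX1 with h1 | h1 <;> have h' := hlX.symm <;> rw [h1] at h'
      · have := intCast_inj_of_abs_sub_lt (R := k) (a := 1) (b := Module.finrank k H)
          (by simpa [hl.map_one] using h')
              (by zify at hn hchar; rw [abs_lt]; constructor <;> nlinarith)
        omega
      · have := intCast_inj_of_abs_sub_lt (R := k) (a := 1) (b := -Module.finrank k H)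
          (by simpa [hl.map_one] using h')
              (by zify at hn hchar; rw [abs_lt]; constructor <;> nlinarith)
        omega
    have hmn' := lt_of_le_of_ne hm hmn
    have ham : a = Module.finrank k H * m := by
      refine intCast_inj_of_abs_sub_lt (R := k) (by rw [htm]; push_cast; rfl) ?_
      calc |a - Module.finrank k H * m| ≤ |a| + |Module.finrank k H * m| := abs_sub _ _
        _ = |a| + Module.finrank k H * |m| := by rw [abs_mul, Nat.abs_cast]
        _ ≤ (Module.finrank k H : ℤ) ^ 2 := by nlinarith
        _ < ringChar k := by exact_mod_cast hchar
    have hm0 : m ≠ 0 := by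
      rintro rfl
      rw [hta, ham] at ht
      simp at ht
    have hab : |a| = Module.finrank k H := by
      refine le_antisymm ha ?_
      rw [ham, abs_mul, Nat.abs_cast]
      exact le_mul_of_one_le_right (by positivity) (Int.one_le_abs hm0)
    rcases ha' hab with h | h
    · exact h
    · refine (h2 ?_).elim
      have h1 := congrArg (counit (R := k)) (LinearMap.congr_fun h 1)
      simp only [LinearMap.comp_apply, antipode_one, LinearMap.neg_apply, LinearMap.id_apply,
        map_neg, Bialgebra.counit_one] at h1
      linear_combination h1
  · have h1 : Module.finrank k H = 1 := by omega
    ext x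
    obtain ⟨c, rfl⟩ := (finrank_eq_one_iff_of_nonzero' (1 : H) h10).1 h1 x
    simp

theorem isSemisimpleRing_and_isCosemisimple
    (ht : LinearMap.trace k H (antipode k (A := H) ∘ₗ antipode k (A := H)) ≠ 0) :
    IsSemisimpleRing H ∧ IsCosemisimple k H := by
  obtain ⟨Λ, hΛ, h⟩ := exists_integral_of_trace (k := k) (H := H)
  obtain ⟨l, hl⟩ := exists_isDualIntegral_of_trace ht
  exact ⟨isSemisimpleRing_of_integral Λ hΛ (h ▸ ht), hl.isCosemisimple⟩

end Hopf

end FiniteDimensionalHopf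

/-- Let `H` be a finite-dimensional Hopf algebra over a field `k` with
`char k > (dim H)²`.  Then the following are equivalent:
(i) `H` is semisimple and cosemisimple; (ii) `S_H² = id_H`; (iii) `tr(S_H²) ≠ 0`. -/
theorem larson_radford_large_char (k H : Type*) [Field k] [Ring H]
    [HopfAlgebra k H] [FiniteDimensional k H]
    (hchar : (Module.finrank k H) ^ 2 < ringChar k) :
    ((IsSemisimpleRing H ∧ IsCosemisimple k H) ↔
      HopfAlgebra.antipode (R := k) (A := H) ∘ₗ HopfAlgebra.antipode (R := k) (A := H) =
        LinearMap.id) ∧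
    ((IsSemisimpleRing H ∧ IsCosemisimple k H) ↔
      LinearMap.trace k H
        (HopfAlgebra.antipode (R := k) (A := H) ∘ₗ HopfAlgebra.antipode (R := k) (A := H))
        ≠ 0) := by
  have h1 (h : IsSemisimpleRing H ∧ IsCosemisimple k H) :=
    have := h.1
    FiniteDimensionalHopf.antipode_sq_eq_id h.2 hchar
  have h2 (h : HopfAlgebra.antipode (R := k) (A := H) ∘ₗ
      HopfAlgebra.antipode (R := k) (A := H) = LinearMap.id) :
      LinearMap.trace k H (HopfAlgebra.antipode (R := k) (A := H) ∘ₗ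
        HopfAlgebra.antipode (R := k) (A := H)) ≠ 0 := by
    have h10 : (1 : H) ≠ 0 := fun h ↦ by
      simpa using congrArg (Coalgebra.counit (R := k)) h
    have hnt : Nontrivial H := ⟨1, 0, h10⟩
    have hn0 : 0 < Module.finrank k H := Module.finrank_pos
    rw [h, LinearMap.trace_id]
    exact fun h ↦ (Nat.le_of_dvd hn0 (ringChar.dvd h)).not_gt
      ((Nat.le_self_pow two_ne_zero _).trans_lt hchar)
  have h3 := FiniteDimensionalHopf.isSemisimpleRing_and_isCosemisimple (k := k) (H := H)
  exact ⟨⟨h1, fun h ↦ h3 (h2 h)⟩, ⟨fun h ↦ h2 (h1 h), h3⟩⟩
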